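/- arXiv:0707.1745 — 2 statements merged into one kernel-verified Lean document; each statement's English description precedes it below -/
import Mathlib

section
/- Let 0<q<1 and v>-1. For every n ∈ ℤ, the normalized Hahn–Exton q-Bessel function satisfies |j_v(q^n,q²)| ≤ ((-q²;q²)_∞ · (-q^{2v+2};q²)_∞ / (q^{2v+2};q²)_∞) · M_n, where M_n = 1 if n ≥ 0 and M_n = q^{n²-(2v+1)n} if n < 0. -/
open scoped BigOperators

noncomputable section

/-- Finite q-Pochhammer symbol `(a;q)_n = ∏_{i=0}^{n-1} (1 - a q^i)`. -/
def qPoch (a q : ℝ) (n : ℕ) : ℝ := ∏ i ∈ Finset.range n, (1 - a * q ^ i)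

/-- Infinite q-Pochhammer symbol `(a;q)_∞ = ∏_{i=0}^{∞} (1 - a q^i)`. -/
def qPochInf (a q : ℝ) : ℝ := ∏' i : ℕ, (1 - a * q ^ i)

/-- Normalized Hahn–Exton q-Bessel function `j_v(x,q²)`. -/
def jHE (q v x : ℝ) : ℝ :=
  ∑' n : ℕ, (-1 : ℝ) ^ n * q ^ (n * (n + 1)) * x ^ (2 * n) /
    (qPoch (q ^ 2) (q ^ 2) n * qPoch (q ^ (2 * v + 2)) (q ^ 2) n)

/-- Hahn–Exton q-Bessel function with base `p`:
`J_v(x,p) = (x^v/(p;p)_∞) Σ_{n} (-1)^n p^{n(n+1)/2} (p^{v+n+1};p)_∞ x^{2n}/(p;p)_n`.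
With `p = q²` this is `J_v(x,q²)`. -/
def JHE (p v x : ℝ) : ℝ :=
  (x ^ v / qPochInf p p) *
    ∑' n : ℕ, (-1 : ℝ) ^ n * p ^ (((n : ℝ) * ((n : ℝ) + 1)) / 2) *
      qPochInf (p ^ (v + (n : ℝ) + 1)) p * x ^ (2 * n) / qPoch p p n

/-- The constant `c_{q,v}`. -/
def cqv (q v : ℝ) : ℝ :=
  (1 / (1 - q)) * qPochInf (q ^ (2 * v + 2)) (q ^ 2) / qPochInf (q ^ 2) (q ^ 2)

/-- Jackson q-integral on `[0,∞)`: `∫_0^∞ f(x) d_q x = (1-q) Σ_{n∈ℤ} q^n f(q^n)`. -/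
def jackson (q : ℝ) (f : ℝ → ℝ) : ℝ := (1 - q) * ∑' n : ℤ, q ^ n * f (q ^ n)

/-- The q-lattice `ℝ_q^+ = {q^n : n ∈ ℤ}`. -/
def Rq (q : ℝ) : Set ℝ := {x | ∃ n : ℤ, x = q ^ n}

/-- Membership in `L_{q,1,v}`: the Jackson integral `∫_0^∞ |f(x)| x^{2v+1} d_q x`
converges (absolutely). -/
def memL1 (q v : ℝ) (f : ℝ → ℝ) : Prop :=
  Summable fun n : ℤ => q ^ n * |f (q ^ n)| * (q ^ n) ^ (2 * v + 1 : ℝ)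

/-- q-Bessel Fourier transform `F_{q,v}`. -/
def qFourier (q v : ℝ) (f : ℝ → ℝ) (x : ℝ) : ℝ :=
  cqv q v * jackson q fun t => f t * jHE q v (x * t) * t ^ (2 * v + 1 : ℝ)

/-- q-translation operator `T_{q,x}^v`. -/
def qTrans (q v x : ℝ) (f : ℝ → ℝ) (y : ℝ) : ℝ :=
  cqv q v * jackson q fun t =>
    qFourier q v f t * jHE q v (x * t) * jHE q v (y * t) * t ^ (2 * v + 1 : ℝ)

/-- The kernel `D_v(x,y,z)`. -/
def Dker (q v x y z : ℝ) : ℝ :=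
  (cqv q v) ^ 2 * jackson q fun t =>
    jHE q v (x * t) * jHE q v (y * t) * jHE q v (z * t) * t ^ (2 * v + 1 : ℝ)

/-- Positivity of the q-translation operator `T_{q,x}^v`. -/
def IsPosT (q v x : ℝ) : Prop :=
  ∀ f : ℝ → ℝ, memL1 q v f → (∀ y ∈ Rq q, 0 ≤ f y) → ∀ y ∈ Rq q, 0 ≤ qTrans q v x f y

/-- The positivity domain `Q_v`. -/
def Qset (v : ℝ) : Set ℝ :=
  {q | q ∈ Set.Ioo (0 : ℝ) 1 ∧ ∀ x ∈ Rq q, IsPosT q v x}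

/-- The kernel `E_{v,x}(q^m,q^z,q^k)`. -/
def Ekern (q v x : ℝ) (m z k : ℤ) : ℝ :=
  (1 / ((1 - q) ^ 2 * cqv q v * cqv q (x - v))) *
    q ^ (-(k : ℝ) * (x + 2) - (m : ℝ) * v - (z : ℝ) * (x - v)) *
    JHE (q ^ 2) ((z : ℝ) - (k : ℝ)) (q ^ (x - v + (m : ℝ) - (k : ℝ))) *
    JHE (q ^ 2) (v + (z : ℝ) - (k : ℝ)) (q ^ ((m : ℝ) - (k : ℝ)))

/-- The function `q ↦ ₁φ₁(0;q;q,q) = Σ_{n} (-1)^n q^{n(n+1)/2} q^n /((q;q)_n)²`. -/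
def phiQ (q : ℝ) : ℝ :=
  ∑' n : ℕ, (-1 : ℝ) ^ n * q ^ (((n : ℝ) * ((n : ℝ) + 1)) / 2) * q ^ n / (qPoch q q n) ^ 2

open Filter Topology

/-- Coefficients of Euler's expansion of `(-x;p)_∞` in powers of `x`. -/
def eulerCoeff (p : ℝ) (k : ℕ) : ℝ := p ^ k.choose 2 / qPoch p p k

/-- Euler's series `Σ_k p^{k(k-1)/2} (-x)^k / (p;p)_k`, which sums to `(x;p)_∞`. -/
def eulerSeries (p x : ℝ) : ℝ := ∑' k : ℕ, eulerCoeff p k * (-x) ^ k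

theorem qPoch_succ (a p : ℝ) (n : ℕ) : qPoch a p (n + 1) = qPoch a p n * (1 - a * p ^ n) :=
  Finset.prod_range_succ _ _

theorem qPoch_pos {a p : ℝ} (hp0 : 0 ≤ p) (hp1 : p ≤ 1) (ha0 : 0 ≤ a) (ha1 : a < 1) (n : ℕ) :
    0 < qPoch a p n := by
  refine Finset.prod_pos fun i _ => ?_
  have := mul_le_of_le_one_right ha0 (pow_le_one₀ hp0 hp1 : p ^ i ≤ 1)
  linarith

theorem qPoch_mem_Icc {a p : ℝ} (hp0 : 0 ≤ p) (hp1 : p ≤ 1) (ha0 : 0 ≤ a) (ha1 : a ≤ 1) (n : ℕ) :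
    qPoch a p n ∈ Set.Icc (0 : ℝ) 1 := by
  have h (i : ℕ) : 0 ≤ 1 - a * p ^ i := by
    have := mul_le_of_le_one_right ha0 (pow_le_one₀ hp0 hp1 : p ^ i ≤ 1)
    linarith
  refine ⟨Finset.prod_nonneg fun i _ => h i, Finset.prod_le_one (fun i _ => h i) fun i _ => ?_⟩
  have : 0 ≤ a * p ^ i := by positivity
  linarith

theorem choose_two_succ (k : ℕ) : (k + 1).choose 2 = k.choose 2 + k := by
  rw [Nat.choose_succ_succ' k 1, Nat.choose_one_right, add_comm]

theorem add_choose_two (m l : ℕ) : (m + l).choose 2 = m.choose 2 + l.choose 2 + m * l := by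
  induction l with
  | zero => simp
  | succ l ih => rw [← add_assoc, choose_two_succ, choose_two_succ, ih]; ring

theorem eulerCoeff_zero (p : ℝ) : eulerCoeff p 0 = 1 := by simp [eulerCoeff, qPoch]

theorem eulerCoeff_pos {p : ℝ} (hp0 : 0 < p) (hp1 : p < 1) (k : ℕ) : 0 < eulerCoeff p k :=
  div_pos (pow_pos hp0 _) (qPoch_pos hp0.le hp1.le hp0.le hp1 k)

theorem eulerCoeff_succ_mul {p : ℝ} (hp0 : 0 < p) (hp1 : p < 1) (k : ℕ) :
    eulerCoeff p (k + 1) * (1 - p ^ (k + 1)) = eulerCoeff p k * p ^ k := by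
  have h1 : qPoch p p k ≠ 0 := (qPoch_pos hp0.le hp1.le hp0.le hp1 k).ne'
  have h2 : (1 - p ^ (k + 1)) ≠ 0 := (sub_pos.2 (pow_lt_one₀ hp0.le hp1 k.succ_ne_zero)).ne'
  have h3 : 1 - p * p ^ k = 1 - p ^ (k + 1) := by ring
  rw [eulerCoeff, eulerCoeff, qPoch_succ, choose_two_succ, pow_add, h3]
  field_simp

theorem summable_eulerCoeff {p : ℝ} (hp0 : 0 < p) (hp1 : p < 1) (x : ℝ) :
    Summable fun k => eulerCoeff p k * x ^ k := by
  have hp : Tendsto (fun k : ℕ => p ^ k) atTop (𝓝 0) :=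
    tendsto_pow_atTop_nhds_zero_of_lt_one hp0.le hp1
  have hlim : Tendsto (fun k : ℕ => p ^ k / (1 - p ^ (k + 1)) * |x|) atTop (𝓝 0) := by
    have := (hp.div (tendsto_const_nhds.sub ((tendsto_add_atTop_iff_nat 1).2 hp))
      (by norm_num : (1 : ℝ) - 0 ≠ 0)).mul_const |x|
    simpa using this
  refine summable_of_ratio_norm_eventually_le (r := 1 / 2) (by norm_num) ?_
  filter_upwards [hlim.eventually_le_const (by norm_num : (0 : ℝ) < 1 / 2)] with k hk
  have h2 : 0 < 1 - p ^ (k + 1) := sub_pos.2 (pow_lt_one₀ hp0.le hp1 k.succ_ne_zero)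
  have h : eulerCoeff p (k + 1) * x ^ (k + 1) =
      (p ^ k / (1 - p ^ (k + 1)) * x) * (eulerCoeff p k * x ^ k) := by
    rw [eq_div_of_mul_eq h2.ne' (eulerCoeff_succ_mul hp0 hp1 k)]
    ring
  rw [h, norm_mul]
  refine mul_le_mul_of_nonneg_right ?_ (norm_nonneg _)
  rwa [norm_mul, Real.norm_eq_abs, Real.norm_eq_abs,
    abs_of_pos (div_pos (pow_pos hp0 k) h2)]

theorem eulerSeries_eq_mul {p : ℝ} (hp0 : 0 < p) (hp1 : p < 1) (x : ℝ) :
    eulerSeries p x = (1 - x) * eulerSeries p (x * p) := by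
  have h1 := summable_eulerCoeff hp0 hp1 (-x)
  have h2 := summable_eulerCoeff hp0 hp1 (-(x * p))
  have h : eulerSeries p x - eulerSeries p (x * p) = -x * eulerSeries p (x * p) := by
    unfold eulerSeries
    rw [← h1.tsum_sub h2, (h1.sub h2).tsum_eq_zero_add, ← tsum_mul_left]
    simp only [pow_zero, sub_self, zero_add]
    refine tsum_congr fun k => ?_
    calc eulerCoeff p (k + 1) * (-x) ^ (k + 1) - eulerCoeff p (k + 1) * (-(x * p)) ^ (k + 1)
        = eulerCoeff p (k + 1) * (1 - p ^ (k + 1)) * (-x) ^ (k + 1) := by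
          rw [← neg_mul, mul_pow]; ring
      _ = -x * (eulerCoeff p k * (-(x * p)) ^ k) := by
          rw [eulerCoeff_succ_mul hp0 hp1, ← neg_mul, mul_pow]; ring
  linarith

theorem eulerSeries_eq_qPoch_mul {p : ℝ} (hp0 : 0 < p) (hp1 : p < 1) (x : ℝ) (n : ℕ) :
    eulerSeries p x = qPoch x p n * eulerSeries p (x * p ^ n) := by
  induction n with
  | zero => simp [qPoch]
  | succ n ih =>
    rw [ih, eulerSeries_eq_mul hp0 hp1 (x * p ^ n), qPoch_succ, pow_succ]
    ring_nf

theorem tendsto_eulerSeries {p : ℝ} (hp0 : 0 < p) (hp1 : p < 1) (x : ℝ) :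
    Tendsto (fun n : ℕ => eulerSeries p (x * p ^ n)) atTop (𝓝 1) := by
  have hlim : ∑' k : ℕ, eulerCoeff p k * (0 : ℝ) ^ k = 1 := by
    rw [tsum_eq_single 0 fun k hk => by simp [hk]]
    simp [eulerCoeff_zero]
  rw [← hlim]
  have hp : Tendsto (fun n : ℕ => -(x * p ^ n)) atTop (𝓝 0) := by
    simpa using ((tendsto_pow_atTop_nhds_zero_of_lt_one hp0.le hp1).const_mul x).neg
  refine tendsto_tsum_of_dominated_convergence (summable_eulerCoeff hp0 hp1 |x|)
    (fun k => (hp.pow k).const_mul _) (.of_forall fun n k => ?_)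
  rw [norm_mul, norm_pow, norm_neg, norm_mul, norm_pow, Real.norm_of_nonneg hp0.le,
    Real.norm_of_nonneg (eulerCoeff_pos hp0 hp1 k).le, Real.norm_eq_abs]
  refine mul_le_mul_of_nonneg_left ?_ (eulerCoeff_pos hp0 hp1 k).le
  exact pow_le_pow_left₀ (by positivity)
    (mul_le_of_le_one_right (abs_nonneg x) (pow_le_one₀ hp0.le hp1.le)) k

theorem tendsto_qPoch_eulerSeries {p : ℝ} (hp0 : 0 < p) (hp1 : p < 1) (x : ℝ) :
    Tendsto (qPoch x p) atTop (𝓝 (eulerSeries p x)) := by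
  have h := tendsto_eulerSeries hp0 hp1 x
  have h' : Tendsto (fun n : ℕ => eulerSeries p x / eulerSeries p (x * p ^ n)) atTop
      (𝓝 (eulerSeries p x)) := by
    simpa [Pi.div_def] using (tendsto_const_nhds (x := eulerSeries p x)).div h one_ne_zero
  refine h'.congr' ?_
  filter_upwards [h.eventually_ne one_ne_zero] with n hn
  rw [div_eq_iff hn, ← eulerSeries_eq_qPoch_mul hp0 hp1]

/-- Euler's identity. -/
theorem qPochInf_eq_eulerSeries {p : ℝ} (hp0 : 0 < p) (hp1 : p < 1) (x : ℝ) :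
    qPochInf x p = eulerSeries p x := by
  have hm : Multipliable fun i : ℕ => 1 - x * p ^ i := by
    simpa [sub_eq_add_neg] using Real.multipliable_one_add_of_summable
      ((summable_geometric_of_lt_one hp0.le hp1).mul_left x).neg
  exact tendsto_nhds_unique hm.hasProd.tendsto_prod_nat (tendsto_qPoch_eulerSeries hp0 hp1 x)

theorem eulerSeries_pos {p : ℝ} (hp0 : 0 < p) (hp1 : p < 1) {x : ℝ} (hx0 : 0 ≤ x) (hx1 : x < 1) :
    0 < eulerSeries p x := by
  obtain ⟨n, hn⟩ := ((tendsto_eulerSeries hp0 hp1 x).eventually_const_lt one_pos).exists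
  rw [eulerSeries_eq_qPoch_mul hp0 hp1 x n]
  exact mul_pos (qPoch_pos hp0.le hp1.le hx0 hx1 n) hn

theorem eulerSeries_mem_Icc {p : ℝ} (hp0 : 0 < p) (hp1 : p < 1) {x : ℝ} (hx0 : 0 ≤ x)
    (hx1 : x ≤ 1) : eulerSeries p x ∈ Set.Icc (0 : ℝ) 1 :=
  isClosed_Icc.mem_of_tendsto (tendsto_qPoch_eulerSeries hp0 hp1 x)
    (.of_forall fun n => qPoch_mem_Icc hp0.le hp1.le hx0 hx1 n)

theorem abs_eulerSeries_le {p : ℝ} (hp0 : 0 < p) (hp1 : p < 1) {x y : ℝ} (hxy : |x| ≤ y) :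
    |eulerSeries p x| ≤ eulerSeries p (-y) := by
  have hy := summable_eulerCoeff hp0 hp1 y
  simp only [eulerSeries, neg_neg, ← Real.norm_eq_abs]
  refine tsum_of_norm_bounded hy.hasSum fun k => ?_
  rw [norm_mul, norm_pow, norm_neg, Real.norm_of_nonneg (eulerCoeff_pos hp0 hp1 k).le]
  exact mul_le_mul_of_nonneg_left (pow_le_pow_left₀ (abs_nonneg x) hxy k)
    (eulerCoeff_pos hp0 hp1 k).le

theorem one_le_eulerSeries_neg {p : ℝ} (hp0 : 0 < p) (hp1 : p < 1) {y : ℝ} (hy : 0 ≤ y) :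
    1 ≤ eulerSeries p (-y) := by
  have h := (summable_eulerCoeff hp0 hp1 y).le_tsum 0 fun k _ =>
    mul_nonneg (eulerCoeff_pos hp0 hp1 k).le (pow_nonneg hy k)
  simpa [eulerSeries, eulerCoeff_zero] using h

theorem eulerSeries_inv_pow {p : ℝ} (hp0 : 0 < p) (hp1 : p < 1) (j : ℕ) :
    eulerSeries p (p ^ j)⁻¹ = 0 := by
  rw [eulerSeries_eq_qPoch_mul hp0 hp1 _ (j + 1), qPoch_succ,
    inv_mul_cancel₀ (pow_pos hp0 j).ne', sub_self, mul_zero, zero_mul]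

/-- The symmetry in `z` and `w` of `(w;p)_∞ ₁φ₁(0;w;p,z)`. -/
theorem tsum_eulerCoeff_mul_eulerSeries_comm {p : ℝ} (hp0 : 0 < p) (hp1 : p < 1) (z w : ℝ) :
    ∑' k : ℕ, eulerCoeff p k * (-z) ^ k * eulerSeries p (w * p ^ k) =
      ∑' k : ℕ, eulerCoeff p k * (-w) ^ k * eulerSeries p (z * p ^ k) := by
  have hsum : Summable fun x : ℕ × ℕ =>
      (eulerCoeff p x.1 * (-z) ^ x.1) * (eulerCoeff p x.2 * (-w) ^ x.2) * p ^ (x.1 * x.2) := by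
    have hz := (summable_eulerCoeff hp0 hp1 (-z)).norm
    have hw := (summable_eulerCoeff hp0 hp1 (-w)).norm
    refine Summable.of_norm_bounded (summable_mul_of_summable_norm hz hw).norm fun x => ?_
    rw [norm_mul, norm_pow, Real.norm_of_nonneg hp0.le]
    exact mul_le_of_le_one_right (norm_nonneg _) (pow_le_one₀ hp0.le hp1.le)
  have h (z w : ℝ) (k : ℕ) : eulerCoeff p k * (-z) ^ k * eulerSeries p (w * p ^ k) =
      ∑' l : ℕ, (eulerCoeff p k * (-z) ^ k) * (eulerCoeff p l * (-w) ^ l) * p ^ (k * l) := by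
    rw [eulerSeries, ← tsum_mul_left]
    refine tsum_congr fun l => ?_
    rw [← neg_mul, mul_pow, ← pow_mul]
    ring
  rw [tsum_congr (h z w), tsum_congr (h w z), ← Summable.tsum_comm (f := fun k l : ℕ =>
    (eulerCoeff p k * (-z) ^ k) * (eulerCoeff p l * (-w) ^ l) * p ^ (k * l)) hsum]
  refine tsum_congr fun l => tsum_congr fun k => ?_
  rw [mul_comm k l, mul_comm (eulerCoeff p k * (-z) ^ k)]

theorem abs_tsum_eulerCoeff_mul_eulerSeries_le {p : ℝ} (hp0 : 0 < p) (hp1 : p < 1) {z w : ℝ}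
    (hz0 : 0 ≤ z) (hzp : z ≤ p) (hw0 : 0 ≤ w) :
    |∑' k : ℕ, eulerCoeff p k * (-z) ^ k * eulerSeries p (w * p ^ k)| ≤
      eulerSeries p (-p) * eulerSeries p (-w) := by
  have hp := (summable_eulerCoeff hp0 hp1 p).hasSum.mul_right (eulerSeries p (-w))
  have hE : eulerSeries p (-p) = ∑' k : ℕ, eulerCoeff p k * p ^ k := by simp [eulerSeries]
  rw [hE, ← Real.norm_eq_abs]
  refine tsum_of_norm_bounded hp fun k => ?_
  rw [norm_mul, norm_mul, norm_pow, norm_neg, Real.norm_of_nonneg hz0,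
    Real.norm_of_nonneg (eulerCoeff_pos hp0 hp1 k).le]
  refine mul_le_mul (mul_le_mul_of_nonneg_left (pow_le_pow_left₀ hz0 hzp k)
    (eulerCoeff_pos hp0 hp1 k).le) ?_ (norm_nonneg _)
    (mul_nonneg (eulerCoeff_pos hp0 hp1 k).le (pow_nonneg hp0.le k))
  refine abs_eulerSeries_le hp0 hp1 ?_
  rw [abs_of_nonneg (by positivity)]
  exact mul_le_of_le_one_right hw0 (pow_le_one₀ hp0.le hp1.le)

theorem eulerCoeff_add_mul_eulerSeries_le {p : ℝ} (hp0 : 0 < p) (hp1 : p < 1) (m l : ℕ) :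
    eulerCoeff p (m + l) * eulerSeries p (p ^ (l + 1)) ≤ p ^ m.choose 2 * eulerCoeff p l := by
  have hP (n : ℕ) : 0 < qPoch p p n := qPoch_pos hp0.le hp1.le hp0.le hp1 n
  have hE (n : ℕ) : eulerSeries p p = qPoch p p n * eulerSeries p (p ^ (n + 1)) := by
    rw [eulerSeries_eq_qPoch_mul hp0 hp1 p n, pow_succ']
  have h1 : eulerSeries p (p ^ (l + 1)) =
      qPoch p p (m + l) * eulerSeries p (p ^ (m + l + 1)) / qPoch p p l := by
    rw [eq_div_iff (hP l).ne', ← hE, mul_comm, ← hE]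
  have h2 : eulerCoeff p (m + l) * eulerSeries p (p ^ (l + 1)) =
      p ^ m.choose 2 * eulerCoeff p l * (p ^ (m * l) * eulerSeries p (p ^ (m + l + 1))) := by
    rw [h1, eulerCoeff, eulerCoeff, add_choose_two, pow_add, pow_add]
    field_simp [(hP l).ne', (hP (m + l)).ne']
  obtain ⟨h3, h4⟩ := eulerSeries_mem_Icc hp0 hp1 (pow_nonneg hp0.le (m + l + 1))
    (pow_le_one₀ hp0.le hp1.le)
  rw [h2]
  exact mul_le_of_le_one_right (mul_nonneg (by positivity) (eulerCoeff_pos hp0 hp1 l).le)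
    (mul_le_one₀ (pow_le_one₀ hp0.le hp1.le) h3 h4)

theorem abs_tsum_eulerCoeff_mul_eulerSeries_inv_pow_le {p : ℝ} (hp0 : 0 < p) (hp1 : p < 1)
    {w : ℝ} (hw0 : 0 ≤ w) (j : ℕ) :
    |∑' k : ℕ, eulerCoeff p k * (-w) ^ k * eulerSeries p ((p ^ j)⁻¹ * p ^ k)| ≤
      p ^ (j + 1).choose 2 * w ^ (j + 1) * eulerSeries p (-w) := by
  have hpow (k : ℕ) (hk : k ≤ j) : (p ^ j)⁻¹ * p ^ k = (p ^ (j - k))⁻¹ := by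
    rw [pow_sub₀ _ hp0.ne' hk, mul_inv, inv_inv]
  have hpow' (l : ℕ) : (p ^ j)⁻¹ * p ^ (l + (j + 1)) = p ^ (l + 1) := by
    rw [← add_assoc, add_right_comm, pow_add p (l + 1) j, mul_comm, mul_assoc,
      mul_inv_cancel₀ (pow_pos hp0 j).ne', mul_one]
  have hzero : ∀ k ∉ Set.range (fun l : ℕ => l + (j + 1)),
      eulerCoeff p k * (-w) ^ k * eulerSeries p ((p ^ j)⁻¹ * p ^ k) = 0 := by
    intro k hk
    have hkj : k ≤ j := by
      by_contra! h
      exact hk ⟨k - (j + 1), Nat.sub_add_cancel h⟩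
    rw [hpow k hkj, eulerSeries_inv_pow hp0 hp1, mul_zero]
  rw [← (add_left_injective (j + 1)).tsum_eq (Function.support_subset_iff'.2 hzero)]
  have hw : eulerSeries p (-w) = ∑' k : ℕ, eulerCoeff p k * w ^ k := by simp [eulerSeries]
  rw [hw, ← Real.norm_eq_abs]
  refine tsum_of_norm_bounded ((summable_eulerCoeff hp0 hp1 w).hasSum.mul_left _) fun l => ?_
  have hE := (eulerSeries_mem_Icc hp0 hp1 (pow_nonneg hp0.le (l + 1))
    (pow_le_one₀ hp0.le hp1.le)).1
  rw [hpow', norm_mul, norm_mul, norm_pow, norm_neg, Real.norm_of_nonneg hw0,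
    Real.norm_of_nonneg (eulerCoeff_pos hp0 hp1 _).le, Real.norm_of_nonneg hE]
  have h := mul_le_mul_of_nonneg_right (eulerCoeff_add_mul_eulerSeries_le hp0 hp1 (j + 1) l)
    (pow_nonneg hw0 (l + (j + 1)))
  rw [add_comm (j + 1) l] at h
  calc _ = _ := by ring
    _ ≤ _ := h
    _ = _ := by ring

theorem eulerSeries_mul_jHE {q v x : ℝ} (hq0 : 0 < q) (hq1 : q < 1) (hv : -1 < v) :
    eulerSeries (q ^ 2) (q ^ (2 * v + 2)) * jHE q v x =
      ∑' k : ℕ, eulerCoeff (q ^ 2) k * (-(q ^ 2 * x ^ 2)) ^ k *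
        eulerSeries (q ^ 2) (q ^ (2 * v + 2) * (q ^ 2) ^ k) := by
  have hp0 : 0 < q ^ 2 := by positivity
  have hp1 : q ^ 2 < 1 := pow_lt_one₀ hq0.le hq1 two_ne_zero
  have ha1 : q ^ (2 * v + 2) < 1 := Real.rpow_lt_one hq0.le hq1 (by linarith)
  rw [jHE, ← tsum_mul_left]
  refine tsum_congr fun k => ?_
  have h1 := (qPoch_pos hp0.le hp1.le (Real.rpow_nonneg hq0.le _) ha1 k).ne'
  have h2 := (qPoch_pos hp0.le hp1.le hp0.le hp1 k).ne'
  have hexp : k * (k + 1) = 2 * k.choose 2 + 2 * k := by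
    have h : (k + 1).choose 2 * 2 = (k + 1) * k := by
      rw [Nat.choose_two_right, Nat.div_mul_cancel (Nat.even_mul_pred_self _).two_dvd]; rfl
    rw [choose_two_succ] at h
    linarith
  generalize q ^ (2 * v + 2) = a at h1 ⊢
  rw [eulerSeries_eq_qPoch_mul hp0 hp1 a k, eulerCoeff, hexp, pow_add, pow_mul,
    pow_mul, pow_mul, ← neg_one_mul (q ^ 2 * x ^ 2), mul_pow, mul_pow]
  field_simp

/-- bound on the normalized Hahn–Exton q-Bessel function. -/
theorem stmt0 (q v : ℝ) (hq0 : 0 < q) (hq1 : q < 1) (hv : -1 < v) (n : ℤ) :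
    |jHE q v (q ^ n)| ≤
      (qPochInf (-(q ^ 2)) (q ^ 2) * qPochInf (-(q ^ (2 * v + 2))) (q ^ 2) /
          qPochInf (q ^ (2 * v + 2)) (q ^ 2)) *
        (if 0 ≤ n then (1 : ℝ)
         else q ^ ((n : ℝ) ^ 2 - (2 * v + 1) * (n : ℝ))) := by
  have hp0 : 0 < q ^ 2 := by positivity
  have hp1 : q ^ 2 < 1 := pow_lt_one₀ hq0.le hq1 two_ne_zero
  have ha0 : 0 < q ^ (2 * v + 2) := Real.rpow_pos_of_pos hq0 _
  have ha1 : q ^ (2 * v + 2) < 1 := Real.rpow_lt_one hq0.le hq1 (by linarith)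
  have hE := eulerSeries_pos hp0 hp1 ha0.le ha1
  simp only [qPochInf_eq_eulerSeries hp0 hp1]
  rw [div_mul_eq_mul_div, le_div_iff₀ hE, mul_comm |_|, ← abs_of_pos hE, ← abs_mul,
    eulerSeries_mul_jHE hq0 hq1 hv]
  split_ifs with hn
  · lift n to ℕ using hn
    rw [mul_one, zpow_natCast]
    refine abs_tsum_eulerCoeff_mul_eulerSeries_le hp0 hp1 (by positivity) ?_ ha0.le
    exact mul_le_of_le_one_right hp0.le (pow_le_one₀ (by positivity) (pow_le_one₀ hq0.le hq1.le))
  · obtain ⟨j, rfl⟩ : ∃ j : ℕ, n = -((j : ℤ) + 1) := ⟨(-n - 1).toNat, by omega⟩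
    have hz : q ^ 2 * (q ^ (-((j : ℤ) + 1))) ^ 2 = ((q ^ 2) ^ j)⁻¹ := by
      rw [zpow_neg, ← Nat.cast_succ, Nat.succ_eq_add_one, zpow_natCast]
      field_simp
      ring
    have hpow : (q ^ 2) ^ (j + 1).choose 2 * (q ^ (2 * v + 2)) ^ (j + 1) =
        q ^ (((-((j : ℤ) + 1) : ℤ) : ℝ) ^ 2 - (2 * v + 1) * ((-((j : ℤ) + 1) : ℤ) : ℝ)) := by
      rw [← pow_mul, ← Real.rpow_natCast q, ← Real.rpow_natCast (q ^ (2 * v + 2)),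
        ← Real.rpow_mul hq0.le, ← Real.rpow_add hq0]
      congr 1
      push_cast [Nat.cast_choose_two]
      ring
    rw [hz, tsum_eulerCoeff_mul_eulerSeries_comm hp0 hp1, ← hpow]
    refine (abs_tsum_eulerCoeff_mul_eulerSeries_inv_pow_le hp0 hp1 ha0.le j).trans ?_
    rw [mul_comm]
    refine mul_le_mul_of_nonneg_right ?_ (by positivity)
    exact le_mul_of_one_le_left (zero_le_one.trans (one_le_eulerSeries_neg hp0 hp1 ha0.le))
      (one_le_eulerSeries_neg hp0 hp1 hp0.le)
end
end

section
/- Let 0<q<1, let z, m ∈ ℤ and let v, x be real numbers with x > -1 and x - v > -1. Then the following reformulation of Graf's addition formula holds, with the bilateral series converging absolutely: J_v(q^m,q²) · J_{x-v}(q^z,q²) = Σ_{k∈ℤ} J_{z-k}(q^{m+x-v-k},q²) · J_{v+z-k}(q^{m-k},q²) · J_x(q^k,q²). -/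
open scoped BigOperators

noncomputable section

open Filter Topology

/-- The reciprocal `1/(p;p)_n`, extended by zero to negative integers `n`. -/
def invPoch (p : ℝ) (n : ℤ) : ℝ := if 0 ≤ n then (qPoch p p n.toNat)⁻¹ else 0

section pochhammer

variable {p : ℝ}

theorem qPoch_self_pos (hp0 : 0 < p) (hp1 : p < 1) (n : ℕ) : 0 < qPoch p p n := by
  refine Finset.prod_pos fun i _ => ?_
  rw [← pow_succ', sub_pos]
  exact pow_lt_one₀ hp0.le hp1 (Nat.succ_ne_zero i)

theorem invPoch_natCast (n : ℕ) : invPoch p n = (qPoch p p n)⁻¹ := by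
  simp [invPoch]

theorem invPoch_of_neg {n : ℤ} (hn : n < 0) : invPoch p n = 0 := by
  simp [invPoch, not_le.mpr hn]

theorem invPoch_zero : invPoch p 0 = 1 := by
  simp [invPoch, qPoch]

theorem invPoch_nonneg (hp0 : 0 < p) (hp1 : p < 1) (n : ℤ) : 0 ≤ invPoch p n := by
  unfold invPoch
  split_ifs
  · exact inv_nonneg.mpr (qPoch_self_pos hp0 hp1 _).le
  · exact le_rfl

theorem invPoch_sub_one (hp0 : 0 < p) (hp1 : p < 1) (n : ℤ) :
    invPoch p (n - 1) = (1 - p ^ n) * invPoch p n := by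
  rcases lt_trichotomy n 0 with h | rfl | h
  · rw [invPoch_of_neg h, invPoch_of_neg (by omega), mul_zero]
  · rw [invPoch_of_neg (by omega)]
    simp
  · obtain ⟨k, rfl⟩ : ∃ k : ℕ, n = (k : ℤ) + 1 := ⟨(n - 1).toNat, by omega⟩
    have h1 := (qPoch_self_pos hp0 hp1 k).ne'
    have h2 := (qPoch_self_pos hp0 hp1 (k + 1)).ne'
    have h3 : qPoch p p (k + 1) = qPoch p p k * (1 - p ^ (k + 1)) := by
      rw [qPoch, Finset.prod_range_succ, ← qPoch, ← pow_succ']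
    rw [add_sub_cancel_right, invPoch_natCast,
      show ((k : ℤ) + 1) = ((k + 1 : ℕ) : ℤ) by push_cast; rfl, invPoch_natCast, zpow_natCast, h3]
    rw [h3] at h2
    have h4 := right_ne_zero_of_mul h2
    field_simp

theorem summable_norm_mul_pow (hp0 : 0 < p) (hp1 : p < 1) (w : ℝ) :
    Summable fun i : ℕ => ‖-(w * p ^ i)‖ := by
  simp only [norm_neg, norm_mul, norm_pow]
  exact (summable_geometric_of_lt_one (norm_nonneg p)
    (by rwa [Real.norm_of_nonneg hp0.le])).mul_left _

theorem multipliable_one_sub_mul_pow (hp0 : 0 < p) (hp1 : p < 1) (w : ℝ) :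
    Multipliable fun i : ℕ => 1 - w * p ^ i := by
  simpa only [sub_eq_add_neg] using
    multipliable_one_add_of_summable (summable_norm_mul_pow hp0 hp1 w)

theorem tendsto_qPoch (hp0 : 0 < p) (hp1 : p < 1) (w : ℝ) :
    Tendsto (qPoch w p) atTop (𝓝 (qPochInf w p)) :=
  (multipliable_one_sub_mul_pow hp0 hp1 w).hasProd.tendsto_prod_nat

theorem qPochInf_eq_one_sub_mul (hp0 : 0 < p) (hp1 : p < 1) (w : ℝ) :
    qPochInf w p = (1 - w) * qPochInf (w * p) p := by
  have h : (fun i : ℕ => 1 - w * p ^ (i + 1)) = fun i : ℕ => 1 - w * p * p ^ i := by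
    funext i
    ring
  have := tprod_eq_zero_mul' (f := fun i : ℕ => 1 - w * p ^ i)
    (by rw [h]; exact multipliable_one_sub_mul_pow hp0 hp1 _)
  rw [h] at this
  simpa [qPochInf] using this

theorem qPochInf_self_ne_zero (hp0 : 0 < p) (hp1 : p < 1) : qPochInf p p ≠ 0 := by
  have := tprod_one_add_ne_zero_of_summable (f := fun i : ℕ => -(p * p ^ i)) (fun i => ?_)
    (summable_norm_mul_pow hp0 hp1 p)
  · simpa only [← sub_eq_add_neg, qPochInf] using this
  · rw [← sub_eq_add_neg, ← pow_succ', sub_ne_zero]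
    exact (pow_lt_one₀ hp0.le hp1 (Nat.succ_ne_zero i)).ne'

theorem exists_invPoch_le (hp0 : 0 < p) (hp1 : p < 1) :
    ∃ C, 0 ≤ C ∧ ∀ n, invPoch p n ≤ C := by
  have h := (tendsto_qPoch hp0 hp1 p).inv₀ (qPochInf_self_ne_zero hp0 hp1)
  obtain ⟨C, hC⟩ := h.bddAbove_range
  refine ⟨max C 0, le_max_right _ _, fun n => ?_⟩
  unfold invPoch
  split_ifs
  · exact le_max_of_le_left (hC ⟨_, rfl⟩)
  · exact le_max_right _ _

theorem qPochInf_zpow_add_one (hp0 : 0 < p) (hp1 : p < 1) (n : ℤ) :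
    qPochInf (p ^ (n + 1)) p = qPochInf p p * invPoch p n := by
  have step : ∀ n : ℤ, qPochInf (p ^ n) p = (1 - p ^ n) * qPochInf (p ^ (n + 1)) p := fun n => by
    rw [qPochInf_eq_one_sub_mul hp0 hp1, zpow_add_one₀ hp0.ne']
  rcases le_or_gt 0 n with h | h
  · induction n, h using Int.leInduction with
    | base => simp [invPoch_zero]
    | succ n hn ih =>
      rw [step, ← add_sub_cancel_right n 1, invPoch_sub_one hp0 hp1, sub_add_cancel] at ih
      have h1 : 1 - p ^ (n + 1) ≠ 0 := by
        rw [sub_ne_zero]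
        exact (zpow_lt_one₀ hp0 hp1 (by omega)).ne'
      refine mul_left_cancel₀ h1 ?_
      rw [ih]
      ring
  · rw [invPoch_of_neg h, mul_zero]
    induction n, (show n ≤ -1 by omega) using Int.leInductionDown with
    | base => rw [step]; simp
    | pred n hn ih => rw [sub_add_cancel, step, ih (by omega), mul_zero]

theorem tsum_natCast_mul_invPoch (f : ℤ → ℝ) :
    ∑' n : ℕ, f n * invPoch p n = ∑' n : ℤ, f n * invPoch p n := by
  refine Nat.cast_injective.tsum_eq (f := fun n : ℤ => f n * invPoch p n) fun n hn => ?_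
  by_contra h
  refine hn (mul_eq_zero_of_right _ (invPoch_of_neg ?_))
  by_contra h'
  exact h ⟨n.toNat, by simp; omega⟩

theorem summable_mul_invPoch_of_nat {f : ℤ → ℝ} (hp0 : 0 < p) (hp1 : p < 1) (hf0 : ∀ n, 0 ≤ f n)
    (hf : Summable fun n : ℕ => f n) : Summable fun n : ℤ => f n * invPoch p n := by
  obtain ⟨C, hC0, hC⟩ := exists_invPoch_le hp0 hp1
  refine (Nat.cast_injective.summable_iff fun n hn => ?_).mp
    (Summable.of_nonneg_of_le (fun n : ℕ => ?_) (fun n : ℕ => ?_) (hf.mul_right C))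
  · rw [invPoch_of_neg, mul_zero]
    by_contra h'
    exact hn ⟨n.toNat, by simp; omega⟩
  · exact mul_nonneg (hf0 _) (invPoch_nonneg hp0 hp1 _)
  · exact mul_le_mul_of_nonneg_left (hC _) (hf0 _)

end pochhammer

section expansion

variable {q : ℝ}

theorem summable_rpow_sq_add (hq0 : 0 < q) (hq1 : q < 1) (c : ℝ) :
    Summable fun n : ℕ => q ^ ((n : ℝ) ^ 2 + c * n) := by
  refine summable_of_ratio_test_tendsto_lt_one zero_lt_one
    (Eventually.of_forall fun n => (Real.rpow_pos_of_pos hq0 _).ne') ?_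
  have h : (fun n : ℕ => ‖q ^ (((n + 1 : ℕ) : ℝ) ^ 2 + c * ((n + 1 : ℕ) : ℝ))‖ /
      ‖q ^ ((n : ℝ) ^ 2 + c * n)‖) = fun n : ℕ => q ^ (1 + c) * (q ^ 2) ^ n := by
    funext n
    rw [Real.norm_of_nonneg (Real.rpow_nonneg hq0.le _),
      Real.norm_of_nonneg (Real.rpow_nonneg hq0.le _), ← Real.rpow_sub hq0, ← pow_mul,
      ← Real.rpow_natCast q (2 * n), ← Real.rpow_add hq0]
    congr 1
    push_cast
    ring
  rw [h]
  simpa using (tendsto_pow_atTop_nhds_zero_of_lt_one (by positivity)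
    (pow_lt_one₀ hq0.le hq1 two_ne_zero)).const_mul (q ^ (1 + c))

theorem summable_rpow_sq_add_mul_invPoch (hq0 : 0 < q) (hq1 : q < 1) (c : ℝ) :
    Summable fun n : ℤ => q ^ ((n : ℝ) ^ 2 + c * n) * invPoch (q ^ 2) n :=
  summable_mul_invPoch_of_nat (f := fun n : ℤ => q ^ ((n : ℝ) ^ 2 + c * n)) (by positivity)
    (pow_lt_one₀ hq0.le hq1 two_ne_zero) (fun n => Real.rpow_nonneg hq0.le _)
    (by simpa using summable_rpow_sq_add hq0 hq1 c)

/-- Euler's expansion of the infinite `q`-shifted factorial. -/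
theorem qPochInf_rpow_eq_tsum (hq0 : 0 < q) (hq1 : q < 1) (b : ℝ) :
    qPochInf (q ^ b) (q ^ 2) =
      ∑' j : ℤ, (-1 : ℝ) ^ j * q ^ ((j : ℝ) ^ 2 + (b - 1) * j) * invPoch (q ^ 2) j := by
  have hp0 : 0 < q ^ 2 := by positivity
  have hp1 : q ^ 2 < 1 := pow_lt_one₀ hq0.le hq1 two_ne_zero
  set t : ℝ → ℤ → ℝ := fun b j =>
    (-1 : ℝ) ^ j * q ^ ((j : ℝ) ^ 2 + (b - 1) * j) * invPoch (q ^ 2) j with ht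
  have habs : ∀ b j, ‖t b j‖ = q ^ ((j : ℝ) ^ 2 + (b - 1) * j) * invPoch (q ^ 2) j := fun b j => by
    simp only [ht, Real.norm_eq_abs, abs_mul, abs_neg_one_zpow, one_mul,
      abs_of_pos (Real.rpow_pos_of_pos hq0 _), abs_of_nonneg (invPoch_nonneg hp0 hp1 _)]
  have hsum : ∀ b, Summable (t b) := fun b => by
    refine Summable.of_norm ?_
    simp only [habs]
    exact summable_rpow_sq_add_mul_invPoch hq0 hq1 (b - 1)
  have hstep : ∀ b, ∑' j, t b j = (1 - q ^ b) * ∑' j, t (b + 2) j := fun b => by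
    have h1 : ∑' j, (t b j - t (b + 2) j) = -q ^ b * ∑' j, t (b + 2) j := by
      rw [← tsum_mul_left, ← (Equiv.addRight (1 : ℤ)).tsum_eq]
      refine tsum_congr fun j => ?_
      have h2 := invPoch_sub_one hp0 hp1 (j + 1)
      rw [add_sub_cancel_right] at h2
      simp only [ht, Equiv.coe_addRight, h2]
      rw [zpow_add_one₀ (by norm_num)]
      have e1 : (q ^ 2) ^ (j + 1) = q ^ (2 * (j : ℝ) + 2) := by
        rw [← zpow_natCast, ← zpow_mul, ← Real.rpow_intCast]
        congr 1
        push_cast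
        ring
      have e2 : q ^ (((j + 1 : ℤ) : ℝ) ^ 2 + (b - 1) * ((j + 1 : ℤ) : ℝ)) =
          q ^ b * q ^ ((j : ℝ) ^ 2 + (b + 2 - 1) * j) := by
        rw [← Real.rpow_add hq0]
        congr 1
        push_cast
        ring
      have e3 : q ^ (((j + 1 : ℤ) : ℝ) ^ 2 + (b + 2 - 1) * ((j + 1 : ℤ) : ℝ)) =
          q ^ b * q ^ ((j : ℝ) ^ 2 + (b + 2 - 1) * j) * q ^ (2 * (j : ℝ) + 2) := by
        rw [← Real.rpow_add hq0, ← Real.rpow_add hq0]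
        congr 1
        push_cast
        ring
      rw [e1, e2, e3]
      ring
    rw [(hsum b).tsum_sub (hsum (b + 2))] at h1
    linarith
  have hiter : ∀ n : ℕ, ∑' j, t b j = qPoch (q ^ b) (q ^ 2) n * ∑' j, t (b + 2 * n) j := fun n => by
    induction n with
    | zero => simp [qPoch]
    | succ n ih =>
      rw [ih, hstep, qPoch, qPoch, Finset.prod_range_succ, mul_assoc]
      congr 2
      · rw [Real.rpow_add hq0, ← pow_mul, ← Real.rpow_natCast q (2 * n)]
        push_cast
        rfl
      · push_cast
        ring_nf
  have hlim : Tendsto (fun n : ℕ => ∑' j, t (b + 2 * n) j) atTop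
      (𝓝 (∑' j : ℤ, if j = 0 then 1 else 0)) := by
    refine tendsto_tsum_of_dominated_convergence (hsum b).norm (fun j => ?_)
      (Eventually.of_forall fun n j => ?_)
    · rcases lt_trichotomy j 0 with h | rfl | h
      · simp [ht, invPoch_of_neg h, h.ne]
      · simp [ht, invPoch_zero]
      · have e : (fun n : ℕ => t (b + 2 * n) j) = fun n : ℕ => t b j * (q ^ (2 * j)) ^ n := by
          funext n
          simp only [ht]
          have : q ^ ((j : ℝ) ^ 2 + (b + 2 * n - 1) * j) =
              q ^ ((j : ℝ) ^ 2 + (b - 1) * j) * (q ^ (2 * j)) ^ n := by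
            rw [← zpow_natCast (q ^ (2 * j)), ← zpow_mul, ← Real.rpow_intCast,
              ← Real.rpow_add hq0]
            congr 1
            push_cast
            ring
          rw [this]
          ring
        rw [e, if_neg h.ne']
        simpa using (tendsto_pow_atTop_nhds_zero_of_lt_one (by positivity)
          (zpow_lt_one₀ hq0 hq1 (by omega : 0 < 2 * j))).const_mul (t b j)
    · rw [habs, habs]
      rcases lt_or_ge j 0 with h | h
      · simp [invPoch_of_neg h]
      · refine mul_le_mul_of_nonneg_right ?_ (invPoch_nonneg hp0 hp1 _)
        refine Real.rpow_le_rpow_of_exponent_ge hq0 hq1.le ?_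
        have : (0 : ℝ) ≤ 2 * n * j := mul_nonneg (by positivity) (by exact_mod_cast h)
        linarith
  rw [tsum_ite_eq] at hlim
  have h1 := (tendsto_qPoch hp0 hp1 (q ^ b)).mul hlim
  simp only [← hiter, mul_one] at h1
  exact tendsto_nhds_unique h1 tendsto_const_nhds

theorem JHE_rpow_eq_tsum (hq0 : 0 < q) (a b : ℝ) :
    JHE (q ^ 2) a (q ^ b) = (qPochInf (q ^ 2) (q ^ 2))⁻¹ *
      ∑' n : ℤ, (-1 : ℝ) ^ n * q ^ ((n : ℝ) ^ 2 + n + 2 * b * n + a * b) *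
        qPochInf (q ^ (2 * (a + n + 1))) (q ^ 2) * invPoch (q ^ 2) n := by
  rw [← tsum_natCast_mul_invPoch (fun n : ℤ => (-1 : ℝ) ^ n *
    q ^ ((n : ℝ) ^ 2 + n + 2 * b * n + a * b) * qPochInf (q ^ (2 * (a + n + 1))) (q ^ 2)), JHE,
    div_eq_inv_mul, mul_assoc, ← tsum_mul_left]
  congr 1
  refine tsum_congr fun n => ?_
  rw [invPoch_natCast, div_eq_mul_inv, ← mul_assoc]
  have hpow : ∀ c : ℝ, (q ^ 2) ^ c = q ^ (2 * c) := fun c => by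
    rw [← Real.rpow_natCast q 2, ← Real.rpow_mul hq0.le, Nat.cast_ofNat]
  have e : q ^ (((n : ℤ) : ℝ) ^ 2 + ((n : ℤ) : ℝ) + 2 * b * ((n : ℤ) : ℝ) + a * b) =
      (q ^ b) ^ a * q ^ (2 * ((n : ℝ) * (n + 1) / 2)) * (q ^ b) ^ (2 * n) := by
    rw [← Real.rpow_natCast (q ^ b), ← Real.rpow_mul hq0.le, ← Real.rpow_mul hq0.le,
      ← Real.rpow_add hq0, ← Real.rpow_add hq0]
    congr 1
    push_cast
    ring
  rw [e, hpow, hpow, zpow_natCast, Int.cast_natCast]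
  ring

/-- The Hahn–Exton function is symmetric in its order and the exponent of its argument. -/
theorem JHE_rpow_comm (hq0 : 0 < q) (hq1 : q < 1) (a b : ℝ) :
    JHE (q ^ 2) a (q ^ b) = JHE (q ^ 2) b (q ^ a) := by
  have hp0 : 0 < q ^ 2 := by positivity
  have hp1 : q ^ 2 < 1 := pow_lt_one₀ hq0.le hq1 two_ne_zero
  set t : ℝ → ℝ → ℤ × ℤ → ℝ := fun a b x => (-1 : ℝ) ^ x.1 * (-1 : ℝ) ^ x.2 *
    q ^ (((x.1 : ℝ) + x.2) ^ 2 + x.1 + x.2 + 2 * b * x.1 + 2 * a * x.2 + a * b) *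
      (invPoch (q ^ 2) x.1 * invPoch (q ^ 2) x.2) with ht
  have hnn : ∀ c : ℝ, 0 ≤ fun n : ℤ => q ^ ((n : ℝ) ^ 2 + c * n) * invPoch (q ^ 2) n :=
    fun c n => mul_nonneg (Real.rpow_nonneg hq0.le _) (invPoch_nonneg hp0 hp1 _)
  have hsum : ∀ a b, Summable (t a b) := fun a b => by
    refine Summable.of_norm_bounded (g := fun x : ℤ × ℤ => q ^ (a * b) *
      ((q ^ ((x.1 : ℝ) ^ 2 + (1 + 2 * b) * x.1) * invPoch (q ^ 2) x.1) *
        (q ^ ((x.2 : ℝ) ^ 2 + (1 + 2 * a) * x.2) * invPoch (q ^ 2) x.2))) ?_ fun x => ?_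
    · exact (Summable.mul_of_nonneg (summable_rpow_sq_add_mul_invPoch hq0 hq1 (1 + 2 * b))
        (summable_rpow_sq_add_mul_invPoch hq0 hq1 (1 + 2 * a)) (hnn _) (hnn _)).mul_left _
    · obtain ⟨n, j⟩ := x
      rcases lt_or_ge n 0 with hn | hn
      · simp [ht, invPoch_of_neg hn]
      rcases lt_or_ge j 0 with hj | hj
      · simp [ht, invPoch_of_neg hj]
      have h1 : ‖t a b (n, j)‖ =
          q ^ (((n : ℝ) + j) ^ 2 + n + j + 2 * b * n + 2 * a * j + a * b) *
            (invPoch (q ^ 2) n * invPoch (q ^ 2) j) := by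
        simp only [ht, Real.norm_eq_abs, abs_mul, abs_neg_one_zpow, one_mul,
          abs_of_pos (Real.rpow_pos_of_pos hq0 _), abs_of_nonneg (invPoch_nonneg hp0 hp1 _)]
      have h2 : q ^ (((n : ℝ) + j) ^ 2 + n + j + 2 * b * n + 2 * a * j + a * b) ≤
          q ^ (a * b + ((n : ℝ) ^ 2 + (1 + 2 * b) * n) + ((j : ℝ) ^ 2 + (1 + 2 * a) * j)) := by
        refine Real.rpow_le_rpow_of_exponent_ge hq0 hq1.le ?_
        have : (0 : ℝ) ≤ n * j := mul_nonneg (by exact_mod_cast hn) (by exact_mod_cast hj)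
        nlinarith
      rw [h1]
      refine (mul_le_mul_of_nonneg_right h2 (mul_nonneg (invPoch_nonneg hp0 hp1 _)
        (invPoch_nonneg hp0 hp1 _))).trans_eq ?_
      rw [Real.rpow_add hq0, Real.rpow_add hq0]
      ring
  have key : ∀ a b, JHE (q ^ 2) a (q ^ b) =
      (qPochInf (q ^ 2) (q ^ 2))⁻¹ * ∑' x, t a b x := fun a b => by
    rw [JHE_rpow_eq_tsum hq0, (hsum a b).tsum_prod]
    congr 1
    refine tsum_congr fun n => ?_
    rw [qPochInf_rpow_eq_tsum hq0 hq1, ← tsum_mul_left, ← tsum_mul_right]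
    refine tsum_congr fun j => ?_
    have e : q ^ (((n : ℝ) + j) ^ 2 + n + j + 2 * b * n + 2 * a * j + a * b) =
        q ^ ((n : ℝ) ^ 2 + n + 2 * b * n + a * b) *
          q ^ ((j : ℝ) ^ 2 + (2 * (a + n + 1) - 1) * j) := by
      rw [← Real.rpow_add hq0]
      congr 1
      ring
    simp only [ht, e]
    ring
  rw [key, key, ← (Equiv.prodComm ℤ ℤ).tsum_eq (t a b)]
  congr 1
  refine tsum_congr fun x => ?_
  simp only [ht, Equiv.prodComm_apply, Prod.fst_swap, Prod.snd_swap]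
  ring_nf

/-- Expansion of the Hahn–Exton function of integer order. -/
theorem JHE_intCast_rpow (hq0 : 0 < q) (hq1 : q < 1) (n : ℤ) (b : ℝ) :
    JHE (q ^ 2) n (q ^ b) = ∑' j : ℤ, (-1 : ℝ) ^ j * q ^ ((j : ℝ) * (j + 1) + b * (2 * j + n)) *
      (invPoch (q ^ 2) j * invPoch (q ^ 2) (n + j)) := by
  have hp0 : 0 < q ^ 2 := by positivity
  have hp1 : q ^ 2 < 1 := pow_lt_one₀ hq0.le hq1 two_ne_zero
  rw [JHE_rpow_eq_tsum hq0, ← tsum_mul_left]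
  refine tsum_congr fun j => ?_
  have e : q ^ (2 * ((n : ℝ) + j + 1)) = (q ^ 2) ^ (n + j + 1) := by
    rw [← zpow_natCast, ← zpow_mul, ← Real.rpow_intCast]
    congr 1
    push_cast
    ring
  rw [e, qPochInf_zpow_add_one hp0 hp1]
  have h := qPochInf_self_ne_zero hp0 hp1
  field_simp
  ring_nf

end expansion

section vandermonde

variable {p q : ℝ}

theorem summable_mul_invPoch_sub (g : ℤ → ℝ) (N M : ℤ) :
    Summable fun s => g s * (invPoch p (N - s) * invPoch p (M - s) * invPoch p s) := by
  refine summable_of_ne_finset_zero (s := Finset.Icc 0 N) fun s hs => ?_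
  rw [Finset.mem_Icc, not_and_or, not_le, not_le] at hs
  rcases hs with hs | hs
  · simp [invPoch_of_neg hs]
  · simp [invPoch_of_neg (show N - s < 0 by omega)]

theorem one_sub_zpow_mul_tsum_invPoch (hp0 : 0 < p) (hp1 : p < 1) {N M : ℤ} {c d g g' : ℤ → ℝ}
    {κ : ℝ} (hcd : ∀ s, c s * (1 - p ^ (N - s)) + d s * (1 - p ^ s) = 1 - p ^ N)
    (hg : ∀ s, g s * c s + g (s + 1) * d (s + 1) * (1 - p ^ (M - s)) = κ * g' s) :
    (1 - p ^ N) * ∑' s, g s * (invPoch p (N - s) * invPoch p (M - s) * invPoch p s) =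
      κ * ∑' s, g' s * (invPoch p (N - 1 - s) * invPoch p (M - s) * invPoch p s) := by
  have hA := summable_mul_invPoch_sub (p := p) (fun s => g s * c s) (N - 1) M
  have hB := summable_mul_invPoch_sub (p := p) (fun s => g (s + 1) * d (s + 1)) (N - 1) (M - 1)
  have hB' := (Equiv.subRight (1 : ℤ)).summable_iff.mpr hB
  rw [← tsum_mul_left, ← tsum_mul_left]
  trans ∑' s, (g s * c s * (invPoch p (N - 1 - s) * invPoch p (M - s) * invPoch p s) +
    g s * d s * (invPoch p (N - s) * invPoch p (M - s) * invPoch p (s - 1)))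
  · refine tsum_congr fun s => ?_
    rw [show N - 1 - s = N - s - 1 by ring, invPoch_sub_one hp0 hp1 (N - s),
      invPoch_sub_one hp0 hp1 s, ← hcd s]
    ring
  · have hshift : (fun s => g s * d s *
        (invPoch p (N - s) * invPoch p (M - s) * invPoch p (s - 1))) =
        (fun s => g (s + 1) * d (s + 1) * (invPoch p (N - 1 - s) * invPoch p (M - 1 - s) *
          invPoch p s)) ∘ (Equiv.subRight (1 : ℤ)) := by
      funext s
      simp only [Function.comp_apply, Equiv.subRight_apply, sub_add_cancel,
        sub_sub_sub_cancel_right]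
    have htsum := (Equiv.subRight (1 : ℤ)).tsum_eq (fun s => g (s + 1) * d (s + 1) *
      (invPoch p (N - 1 - s) * invPoch p (M - 1 - s) * invPoch p s))
    rw [Summable.tsum_add hA (by rw [hshift]; exact hB'), hshift]
    refine (congrArg _ htsum).trans ?_
    rw [← Summable.tsum_add hA hB]
    refine tsum_congr fun s => ?_
    rw [show M - 1 - s = M - s - 1 by ring, invPoch_sub_one hp0 hp1 (M - s)]
    linear_combination (invPoch p (N - 1 - s) * invPoch p (M - s) * invPoch p s) * hg s

theorem eq_of_one_sub_zpow_mul_eq (hp0 : 0 < p) (hp1 : p < 1) {f g κ : ℤ → ℝ}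
    (hneg : ∀ n < 0, f n = g n) (hzero : f 0 = g 0)
    (hf : ∀ n, (1 - p ^ n) * f n = κ n * f (n - 1))
    (hg : ∀ n, (1 - p ^ n) * g n = κ n * g (n - 1)) (n : ℤ) : f n = g n := by
  rcases lt_or_ge n 0 with h | h
  · exact hneg n h
  · induction n, h using Int.leInduction with
    | base => exact hzero
    | succ n hn ih =>
      have h1 : 1 - p ^ (n + 1) ≠ 0 := by
        rw [sub_ne_zero]
        exact (zpow_lt_one₀ hp0 hp1 (by omega)).ne'
      refine mul_left_cancel₀ h1 ?_
      rw [hf, hg, add_sub_cancel_right, ih]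

theorem tsum_mul_invPoch_sub_zero (g : ℤ → ℝ) (M : ℤ) :
    ∑' s, g s * (invPoch p (0 - s) * invPoch p (M - s) * invPoch p s) = g 0 * invPoch p M := by
  rw [tsum_eq_single 0]
  · simp [invPoch_zero]
  · intro s hs
    rcases hs.lt_or_gt with h | h
    · simp [invPoch_of_neg h]
    · simp [invPoch_of_neg (show -s < 0 by omega)]

theorem tsum_mul_invPoch_sub_of_neg (g : ℤ → ℝ) {N : ℤ} (hN : N < 0) (M : ℤ) :
    ∑' s, g s * (invPoch p (N - s) * invPoch p (M - s) * invPoch p s) = 0 := by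
  refine (tsum_congr fun s => ?_).trans tsum_zero
  rcases lt_or_ge s 0 with h | h
  · simp [invPoch_of_neg h]
  · simp [invPoch_of_neg (show N - s < 0 by omega)]

/-- The `q`-Chu–Vandermonde summation. -/
theorem tsum_zpow_mul_invPoch (hp0 : 0 < p) (hp1 : p < 1) (N M : ℤ) :
    ∑' s, p ^ ((N - s) * (M - s)) * (invPoch p (N - s) * invPoch p (M - s) * invPoch p s) =
      invPoch p N * invPoch p M := by
  refine eq_of_one_sub_zpow_mul_eq hp0 hp1 (κ := 1)
    (f := fun N => ∑' s, p ^ ((N - s) * (M - s)) *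
      (invPoch p (N - s) * invPoch p (M - s) * invPoch p s))
    (g := fun N => invPoch p N * invPoch p M) (fun n hn => ?_) ?_ (fun n => ?_) (fun n => ?_) N
  · simp only [tsum_mul_invPoch_sub_of_neg _ hn, invPoch_of_neg hn, zero_mul]
  · simp only [tsum_mul_invPoch_sub_zero, invPoch_zero]
    simp
  · refine one_sub_zpow_mul_tsum_invPoch hp0 hp1 (c := 1) (d := fun s => p ^ (n - s))
      (fun s => ?_) (fun s => ?_)
    · rw [mul_sub (p ^ (n - s)), ← zpow_add₀ hp0.ne']
      simp
    · rw [← zpow_add₀ hp0.ne', show (n - (s + 1)) * (M - (s + 1)) + (n - (s + 1)) =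
          (n - 1 - s) * (M - s) by ring, show (n - s) * (M - s) =
          (n - 1 - s) * (M - s) + (M - s) by ring, zpow_add₀ hp0.ne']
      simp only [Pi.one_apply]
      ring
  · simp only [Pi.one_apply, invPoch_sub_one hp0 hp1]
    ring

/-- The alternating `q`-Chu–Vandermonde summation. -/
theorem tsum_neg_one_zpow_mul_invPoch (hq0 : 0 < q) (hq1 : q < 1) (N M : ℤ) :
    ∑' l : ℤ, (-1) ^ l * q ^ (l * (l - 1)) * (invPoch (q ^ 2) (N - l) * invPoch (q ^ 2) (M - l) *
      invPoch (q ^ 2) l) = (q ^ 2) ^ (N * M) * (invPoch (q ^ 2) N * invPoch (q ^ 2) M) := by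
  have hp0 : 0 < q ^ 2 := by positivity
  have hp1 : q ^ 2 < 1 := pow_lt_one₀ hq0.le hq1 two_ne_zero
  refine eq_of_one_sub_zpow_mul_eq hp0 hp1 (κ := fun _ => (q ^ 2) ^ M)
    (f := fun N => ∑' l : ℤ, (-1) ^ l * q ^ (l * (l - 1)) *
      (invPoch (q ^ 2) (N - l) * invPoch (q ^ 2) (M - l) * invPoch (q ^ 2) l))
    (g := fun N => (q ^ 2) ^ (N * M) * (invPoch (q ^ 2) N * invPoch (q ^ 2) M))
    (fun n hn => ?_) ?_ (fun n => ?_) (fun n => ?_) N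
  · simp only [tsum_mul_invPoch_sub_of_neg _ hn, invPoch_of_neg hn, zero_mul, mul_zero]
  · simp only [tsum_mul_invPoch_sub_zero, invPoch_zero]
    simp
  · refine one_sub_zpow_mul_tsum_invPoch hp0 hp1 (c := fun l => (q ^ 2) ^ l) (d := 1)
      (fun l => ?_) (fun l => ?_)
    · rw [mul_sub, ← zpow_add₀ hp0.ne']
      simp
    · have e : q ^ ((l + 1) * (l + 1 - 1)) = q ^ (l * (l - 1)) * (q ^ 2) ^ l := by
        rw [← zpow_natCast, ← zpow_mul, ← zpow_add₀ hq0.ne']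
        congr 1
        push_cast
        ring
      have e' : (q ^ 2) ^ M = (q ^ 2) ^ l * (q ^ 2) ^ (M - l) := by
        rw [← zpow_add₀ hp0.ne', add_sub_cancel]
      rw [e, e', zpow_add_one₀ (by norm_num), Pi.one_apply]
      ring
  · simp only [invPoch_sub_one hp0 hp1]
    rw [show n * M = M + (n - 1) * M by ring, zpow_add₀ hp0.ne']
    ring

end vandermonde

section addition

variable {q : ℝ}

/-- The summand in the expansion of the Hahn–Exton function of integer order `n` at `q ^ b`. -/
def besselTerm (q : ℝ) (n : ℤ) (b : ℝ) (i : ℤ) : ℝ :=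
  (-1) ^ (i - n) * q ^ (((i : ℝ) - n) * (i - n + 1) + b * (2 * i - n)) *
    (invPoch (q ^ 2) (i - n) * invPoch (q ^ 2) i)

theorem JHE_intCast_rpow_eq_tsum_besselTerm (hq0 : 0 < q) (hq1 : q < 1) (n : ℤ) (b : ℝ) :
    JHE (q ^ 2) n (q ^ b) = ∑' i, besselTerm q n b i := by
  rw [JHE_intCast_rpow hq0 hq1, ← (Equiv.subRight n).tsum_eq]
  refine tsum_congr fun i => ?_
  simp only [besselTerm, Equiv.subRight_apply, add_sub_cancel]
  congr 3
  push_cast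
  ring

theorem norm_besselTerm (hq0 : 0 < q) (hq1 : q < 1) (n : ℤ) (b : ℝ) (i : ℤ) :
    ‖besselTerm q n b i‖ = q ^ (((i : ℝ) - n) * (i - n + 1) + b * (2 * i - n)) *
      (invPoch (q ^ 2) (i - n) * invPoch (q ^ 2) i) := by
  have hnn := invPoch_nonneg (p := q ^ 2) (by positivity) (pow_lt_one₀ hq0.le hq1 two_ne_zero)
  simp only [besselTerm, Real.norm_eq_abs, abs_mul, abs_neg_one_zpow, one_mul,
    abs_of_pos (Real.rpow_pos_of_pos hq0 _), abs_of_nonneg (hnn _)]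

theorem summable_norm_besselTerm (hq0 : 0 < q) (hq1 : q < 1) (n : ℤ) (b : ℝ) :
    Summable fun i => ‖besselTerm q n b i‖ := by
  have hp0 : 0 < q ^ 2 := by positivity
  have hp1 : q ^ 2 < 1 := pow_lt_one₀ hq0.le hq1 two_ne_zero
  obtain ⟨C, -, hC⟩ := exists_invPoch_le hp0 hp1
  refine Summable.of_nonneg_of_le (fun i => norm_nonneg _) (fun i => ?_)
    ((summable_rpow_sq_add_mul_invPoch hq0 hq1 (1 - 2 * n + 2 * b)).mul_left
      (q ^ ((n : ℝ) * (n - 1) - b * n) * C))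
  have e : q ^ (((i : ℝ) - n) * (i - n + 1) + b * (2 * i - n)) =
      q ^ ((n : ℝ) * (n - 1) - b * n) * q ^ ((i : ℝ) ^ 2 + (1 - 2 * n + 2 * b) * i) := by
    rw [← Real.rpow_add hq0]
    congr 1
    ring
  have hpos := Real.rpow_pos_of_pos hq0
  calc ‖besselTerm q n b i‖
      ≤ q ^ ((n : ℝ) * (n - 1) - b * n) * q ^ ((i : ℝ) ^ 2 + (1 - 2 * n + 2 * b) * i) *
        (C * invPoch (q ^ 2) i) := by
        rw [norm_besselTerm hq0 hq1, e]
        exact mul_le_mul_of_nonneg_left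
          (mul_le_mul_of_nonneg_right (hC _) (invPoch_nonneg hp0 hp1 _))
          (mul_pos (hpos _) (hpos _)).le
    _ = _ := by ring

theorem summable_rpow_mul_invPoch (hq0 : 0 < q) (hq1 : q < 1) {c : ℝ} (hc : 0 < c) :
    Summable fun n : ℤ => q ^ (c * n) * invPoch (q ^ 2) n := by
  refine summable_mul_invPoch_of_nat (f := fun n : ℤ => q ^ (c * n)) (by positivity)
    (pow_lt_one₀ hq0.le hq1 two_ne_zero) (fun n => Real.rpow_nonneg hq0.le _) ?_
  simp only [Int.cast_natCast, Real.rpow_mul hq0.le, Real.rpow_natCast]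
  exact summable_geometric_of_lt_one (Real.rpow_nonneg hq0.le _) (Real.rpow_lt_one hq0.le hq1 hc)

/-- The summand of the quadruple series underlying Graf's addition formula. -/
def grafTerm (q : ℝ) (z m : ℤ) (u v : ℝ) (y : ℤ × ℤ × ℤ × ℤ) : ℝ :=
  besselTerm q (z - y.1) (m + u - y.1) y.2.1 *
    (besselTerm q (m - y.1) (v + z - y.1) y.2.2.1 * besselTerm q y.1 (u + v) y.2.2.2)

/-- The change of variables `k = s - l`. -/
def shearEquiv : ℤ × ℤ × ℤ × ℤ ≃ ℤ × ℤ × ℤ × ℤ where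
  toFun y := (y.2.2.2 - y.1, y.2)
  invFun y := (y.2.2.2 - y.1, y.2)
  left_inv y := by simp
  right_inv y := by simp

/-- The change of variables `k = s - l`, `i = N - s`, `j = M - s`. -/
def grafEquiv : (ℤ × ℤ) × (ℤ × ℤ) ≃ ℤ × ℤ × ℤ × ℤ where
  toFun y := (y.2.2 - y.2.1, y.1.1 - y.2.2, y.1.2 - y.2.2, y.2.2)
  invFun y := ((y.2.1 + y.2.2.2, y.2.2.1 + y.2.2.2), (y.2.2.2 - y.1, y.2.2.2))
  left_inv y := by simp
  right_inv y := by simp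

theorem summable_norm_grafTerm (hq0 : 0 < q) (hq1 : q < 1) (z m : ℤ) {u v : ℝ}
    (huv : -1 < u + v) : Summable fun y => ‖grafTerm q z m u v y‖ := by
  have hp0 : 0 < q ^ 2 := by positivity
  have hp1 : q ^ 2 < 1 := pow_lt_one₀ hq0.le hq1 two_ne_zero
  obtain ⟨C, hC0, hC⟩ := exists_invPoch_le hp0 hp1
  have hnn := invPoch_nonneg hp0 hp1
  have hpos := Real.rpow_pos_of_pos hq0
  set ψ : ℝ → ℤ → ℝ := fun c n => q ^ ((n : ℝ) ^ 2 + c * n) * invPoch (q ^ 2) n with hψ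
  set φ : ℤ → ℝ := fun n => q ^ ((2 + 2 * (u + v)) * n) * invPoch (q ^ 2) n with hφ
  have hψs : ∀ c, Summable (ψ c) := summable_rpow_sq_add_mul_invPoch hq0 hq1
  have hφs : Summable φ := summable_rpow_mul_invPoch hq0 hq1 (by linarith)
  have hψ0 : ∀ c, 0 ≤ ψ c := fun c n => mul_nonneg (hpos _).le (hnn n)
  have hφ0 : 0 ≤ φ := fun n => mul_nonneg (hpos _).le (hnn n)
  set c₁ : ℝ := 1 - 2 * z + 2 * m + 2 * u
  set c₂ : ℝ := 1 - 2 * m + 2 * v + 2 * z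
  set K : ℝ := -z * (1 + m + u - z) - m * (1 + v + z - m)
  have h34 := (hψs c₂).mul_of_nonneg hφs (hψ0 _) hφ0
  have h34' : 0 ≤ fun y : ℤ × ℤ => ψ c₂ y.1 * φ y.2 := fun y => mul_nonneg (hψ0 _ _) (hφ0 _)
  have h234 := (hψs c₁).mul_of_nonneg h34 (hψ0 _) h34'
  have h234' : 0 ≤ fun y : ℤ × ℤ × ℤ => ψ c₁ y.1 * (ψ c₂ y.2.1 * φ y.2.2) :=
    fun y => mul_nonneg (hψ0 _ _) (h34' _)
  have h1234 := (hψs (-1)).mul_of_nonneg h234 (hψ0 _) h234'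
  refine shearEquiv.summable_iff.mp (Summable.of_nonneg_of_le (fun y => norm_nonneg _)
    (fun y => ?_) (h1234.mul_left (q ^ K * (C * C))))
  obtain ⟨l, i, j, s⟩ := y
  simp only [Function.comp_apply, shearEquiv, Equiv.coe_fn_mk, grafTerm, norm_mul,
    norm_besselTerm hq0 hq1, hψ, hφ, sub_sub_cancel]
  set E₁ : ℝ := ((i : ℝ) - (z - (s - l) : ℤ)) * (i - (z - (s - l) : ℤ) + 1) +
    (m + u - (s - l : ℤ)) * (2 * i - (z - (s - l) : ℤ)) with hE₁
  set E₂ : ℝ := ((j : ℝ) - (m - (s - l) : ℤ)) * (j - (m - (s - l) : ℤ) + 1) +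
    (v + z - (s - l : ℤ)) * (2 * j - (m - (s - l) : ℤ)) with hE₂
  set E₃ : ℝ := ((s : ℝ) - (s - l : ℤ)) * (s - (s - l : ℤ) + 1) +
    (u + v) * (2 * s - (s - l : ℤ)) with hE₃
  have e : q ^ E₁ * q ^ E₂ * q ^ E₃ = q ^ K * q ^ ((l : ℝ) ^ 2 + -1 * l) *
      q ^ ((i : ℝ) ^ 2 + c₁ * i) * q ^ ((j : ℝ) ^ 2 + c₂ * j) *
      q ^ ((2 + 2 * (u + v)) * s) := by
    simp only [← Real.rpow_add hq0]
    congr 1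
    simp only [hE₁, hE₂, hE₃, K, c₁, c₂]
    push_cast
    ring
  calc _ = (q ^ E₁ * q ^ E₂ * q ^ E₃) * (invPoch (q ^ 2) l * invPoch (q ^ 2) i *
        invPoch (q ^ 2) j * invPoch (q ^ 2) s) * (invPoch (q ^ 2) (i - (z - (s - l))) *
        invPoch (q ^ 2) (j - (m - (s - l)))) := by ring
    _ ≤ (q ^ E₁ * q ^ E₂ * q ^ E₃) * (invPoch (q ^ 2) l * invPoch (q ^ 2) i *
        invPoch (q ^ 2) j * invPoch (q ^ 2) s) * (C * C) := by
        refine mul_le_mul_of_nonneg_left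
          (mul_le_mul (hC _) (hC _) (hnn _) hC0) (mul_nonneg ?_ ?_)
        · exact (mul_pos (mul_pos (hpos _) (hpos _)) (hpos _)).le
        · exact mul_nonneg (mul_nonneg (mul_nonneg (hnn _) (hnn _)) (hnn _)) (hnn _)
    _ = _ := by
        rw [e]
        ring

theorem grafTerm_grafEquiv (hq0 : 0 < q) (z m : ℤ) (u v : ℝ) (N M l s : ℤ) :
    grafTerm q z m u v (grafEquiv ((N, M), (l, s))) =
      (-1) ^ (N - z + (M - m)) * q ^ (((M : ℝ) - m) * (M - m + 1) + v * (2 * M - m) +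
        (((N : ℝ) - z) * (N - z + 1) + u * (2 * N - z)) - 2 * ((N - z) * (M - m))) *
      (((-1) ^ l * q ^ (l * (l - 1)) * (invPoch (q ^ 2) (N - z - l) *
        invPoch (q ^ 2) (M - m - l) * invPoch (q ^ 2) l)) *
      ((q ^ 2) ^ ((N - s) * (M - s)) *
        (invPoch (q ^ 2) (N - s) * invPoch (q ^ 2) (M - s) * invPoch (q ^ 2) s))) := by
  simp only [grafTerm, grafEquiv, Equiv.coe_fn_mk, besselTerm, sub_sub_cancel]
  rw [show N - s - (z - (s - l)) = N - z - l by ring,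
    show M - s - (m - (s - l)) = M - m - l by ring]
  set E₁ : ℝ := (((N - s : ℤ) : ℝ) - (z - (s - l) : ℤ)) *
    ((N - s : ℤ) - (z - (s - l) : ℤ) + 1) +
    (m + u - (s - l : ℤ)) * (2 * (N - s : ℤ) - (z - (s - l) : ℤ)) with hE₁
  set E₂ : ℝ := (((M - s : ℤ) : ℝ) - (m - (s - l) : ℤ)) *
    ((M - s : ℤ) - (m - (s - l) : ℤ) + 1) +
    (v + z - (s - l : ℤ)) * (2 * (M - s : ℤ) - (m - (s - l) : ℤ)) with hE₂
  set E₃ : ℝ := ((s : ℝ) - (s - l : ℤ)) * (s - (s - l : ℤ) + 1) +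
    (u + v) * (2 * s - (s - l : ℤ)) with hE₃
  set D : ℝ := ((M : ℝ) - m) * (M - m + 1) + v * (2 * M - m) +
    (((N : ℝ) - z) * (N - z + 1) + u * (2 * N - z)) - 2 * ((N - z) * (M - m)) with hD
  have e : q ^ E₁ * q ^ E₂ * q ^ E₃ =
      q ^ D * q ^ (l * (l - 1)) * (q ^ 2) ^ ((N - s) * (M - s)) := by
    rw [← zpow_natCast, ← zpow_mul, ← Real.rpow_intCast, ← Real.rpow_intCast]
    simp only [← Real.rpow_add hq0]
    congr 1
    simp only [hE₁, hE₂, hE₃, hD]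
    push_cast
    ring
  have hsign : (-1 : ℝ) ^ (N - z - l) * (-1) ^ (M - m - l) = (-1) ^ (N - z + (M - m)) := by
    rw [← zpow_add₀ (by norm_num), show N - z - l + (M - m - l) =
      N - z + (M - m) + 2 * (-l) by ring, zpow_add₀ (by norm_num), zpow_mul]
    simp
  calc _ = ((-1 : ℝ) ^ (N - z - l) * (-1) ^ (M - m - l)) * (-1) ^ l * (q ^ E₁ * q ^ E₂ * q ^ E₃) *
        (invPoch (q ^ 2) (N - z - l) * invPoch (q ^ 2) (M - m - l) * invPoch (q ^ 2) l) *
        (invPoch (q ^ 2) (N - s) * invPoch (q ^ 2) (M - s) * invPoch (q ^ 2) s) := by ring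
    _ = _ := by
        rw [hsign, e]
        ring

theorem tsum_grafTerm_grafEquiv (hq0 : 0 < q) (hq1 : q < 1) (z m : ℤ) (u v : ℝ) (N M : ℤ) :
    ∑' y : ℤ × ℤ, grafTerm q z m u v (grafEquiv ((N, M), y)) =
      besselTerm q z u N * besselTerm q m v M := by
  have hp0 : 0 < q ^ 2 := by positivity
  have hp1 : q ^ 2 < 1 := pow_lt_one₀ hq0.le hq1 two_ne_zero
  have h1 := summable_mul_invPoch_sub (p := q ^ 2)
    (fun l : ℤ => (-1 : ℝ) ^ l * q ^ (l * (l - 1))) (N - z) (M - m)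
  have h2 := summable_mul_invPoch_sub (p := q ^ 2)
    (fun s : ℤ => (q ^ 2) ^ ((N - s) * (M - s))) N M
  rw [tsum_congr fun y : ℤ × ℤ => grafTerm_grafEquiv hq0 z m u v N M y.1 y.2, tsum_mul_left,
    ← tsum_mul_tsum_of_summable_norm h1.norm h2.norm, tsum_neg_one_zpow_mul_invPoch hq0 hq1,
    tsum_zpow_mul_invPoch hp0 hp1, besselTerm, besselTerm, zpow_add₀ (by norm_num)]
  set X : ℝ := ((N : ℝ) - z) * (N - z + 1) + u * (2 * N - z)
  set Y : ℝ := ((M : ℝ) - m) * (M - m + 1) + v * (2 * M - m)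
  have e : q ^ X * q ^ Y =
      q ^ (Y + X - 2 * (((N : ℝ) - z) * (M - m))) * (q ^ 2) ^ ((N - z) * (M - m)) := by
    rw [← zpow_natCast, ← zpow_mul, ← Real.rpow_intCast, ← Real.rpow_add hq0,
      ← Real.rpow_add hq0]
    congr 1
    push_cast
    ring
  linear_combination (-(-1 : ℝ) ^ (N - z) * (-1) ^ (M - m) * (invPoch (q ^ 2) (N - z) *
    invPoch (q ^ 2) N * invPoch (q ^ 2) (M - m) * invPoch (q ^ 2) M)) * e

theorem tsum_grafTerm_fiber (hq0 : 0 < q) (hq1 : q < 1) (z m : ℤ) (u v : ℝ) (k : ℤ) :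
    ∑' y : ℤ × ℤ × ℤ, grafTerm q z m u v (k, y) =
      JHE (q ^ 2) ((z - k : ℤ) : ℝ) (q ^ (m + u - k)) *
        (JHE (q ^ 2) ((m - k : ℤ) : ℝ) (q ^ (v + z - k)) * JHE (q ^ 2) k (q ^ (u + v))) := by
  have h := summable_norm_besselTerm hq0 hq1
  simp only [JHE_intCast_rpow_eq_tsum_besselTerm hq0 hq1]
  rw [tsum_mul_tsum_of_summable_norm (h _ _) (h _ _),
    tsum_mul_tsum_of_summable_norm (h _ _) ((h _ _).mul_norm (h _ _))]
  rfl

/-- Graf's addition formula for orders and arguments in the integer lattice. -/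
theorem hasSum_JHE_mul_JHE (hq0 : 0 < q) (hq1 : q < 1) (z m : ℤ) {u v : ℝ} (huv : -1 < u + v) :
    HasSum (fun k : ℤ => JHE (q ^ 2) ((z - k : ℤ) : ℝ) (q ^ (m + u - k)) *
        (JHE (q ^ 2) ((m - k : ℤ) : ℝ) (q ^ (v + z - k)) * JHE (q ^ 2) k (q ^ (u + v))))
      (JHE (q ^ 2) z (q ^ u) * JHE (q ^ 2) m (q ^ v)) := by
  have hs := (summable_norm_grafTerm hq0 hq1 z m huv).of_norm
  have h := summable_norm_besselTerm hq0 hq1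
  have htot : ∑' y, grafTerm q z m u v y = JHE (q ^ 2) z (q ^ u) * JHE (q ^ 2) m (q ^ v) := by
    have hs' : Summable fun y => grafTerm q z m u v (grafEquiv y) :=
      grafEquiv.summable_iff.mpr hs
    rw [← grafEquiv.tsum_eq, hs'.tsum_prod, JHE_intCast_rpow_eq_tsum_besselTerm hq0 hq1,
      JHE_intCast_rpow_eq_tsum_besselTerm hq0 hq1, tsum_mul_tsum_of_summable_norm (h _ _) (h _ _)]
    exact tsum_congr fun y => tsum_grafTerm_grafEquiv hq0 hq1 z m u v y.1 y.2
  simp only [← tsum_grafTerm_fiber hq0 hq1]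
  rw [← htot, hs.tsum_prod]
  exact hs.prod.hasSum

end addition

/-- reformulated Graf addition formula for Hahn–Exton q-Bessel functions. -/
theorem stmt3 (q : ℝ) (hq0 : 0 < q) (hq1 : q < 1) (z m : ℤ) (v x : ℝ)
    (hx : -1 < x) (hxv : -1 < x - v) :
    Summable (fun k : ℤ =>
        |JHE (q ^ 2) ((z : ℝ) - (k : ℝ)) (q ^ ((m : ℝ) + x - v - (k : ℝ))) *
          JHE (q ^ 2) (v + (z : ℝ) - (k : ℝ)) (q ^ ((m : ℝ) - (k : ℝ))) *
          JHE (q ^ 2) x (q ^ (k : ℤ))|) ∧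
    JHE (q ^ 2) v (q ^ (m : ℤ)) * JHE (q ^ 2) (x - v) (q ^ (z : ℤ)) =
      ∑' k : ℤ,
        JHE (q ^ 2) ((z : ℝ) - (k : ℝ)) (q ^ ((m : ℝ) + x - v - (k : ℝ))) *
          JHE (q ^ 2) (v + (z : ℝ) - (k : ℝ)) (q ^ ((m : ℝ) - (k : ℝ))) *
          JHE (q ^ 2) x (q ^ (k : ℤ)) := by
  have key := hasSum_JHE_mul_JHE hq0 hq1 z m (u := x - v) (v := v) (by linarith)
  have hterm : (fun k : ℤ => JHE (q ^ 2) ((z : ℝ) - k) (q ^ ((m : ℝ) + x - v - k)) *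
      JHE (q ^ 2) (v + z - k) (q ^ ((m : ℝ) - k)) * JHE (q ^ 2) x (q ^ (k : ℤ))) =
      fun k : ℤ => JHE (q ^ 2) ((z - k : ℤ) : ℝ) (q ^ (m + (x - v) - k)) *
        (JHE (q ^ 2) ((m - k : ℤ) : ℝ) (q ^ (v + z - k)) * JHE (q ^ 2) k (q ^ (x - v + v))) := by
    funext k
    rw [← Real.rpow_intCast, JHE_rpow_comm hq0 hq1 x, JHE_rpow_comm hq0 hq1 (v + z - k),
      sub_add_cancel, add_sub_assoc (m : ℝ) x v, Int.cast_sub, Int.cast_sub, mul_assoc]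
  rw [hterm, key.tsum_eq, ← Real.rpow_intCast, ← Real.rpow_intCast, JHE_rpow_comm hq0 hq1 v,
    JHE_rpow_comm hq0 hq1 (x - v)]
  refine ⟨?_, mul_comm _ _⟩
  have := congrArg (fun f : ℤ → ℝ => Summable fun k => |f k|) hterm
  exact this.mpr key.summable.abs
end
end
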